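/- (Main result, equality) For every k ≥ 2, the minimum number m of links of a polygonal chain in ℝ^k covering the vertex set H(2,k) = {0,1}^k equals 3·2^{k−2}: there exists a covering polygonal chain (indeed a closed one) with 3·2^{k−2} links, and no covering polygonal chain has fewer than 3·2^{k−2} links. -/

import Mathlib

/-- The vertices of the unit hypercube in `ℝ^k`. -/
noncomputable def cubeVertices (k : ℕ) : Finset (Fin k → ℝ) :=
  Fintype.piFinset fun _ => {0, 1}

lemma mem_cubeVertices {k : ℕ} {v : Fin k → ℝ} :
    v ∈ cubeVertices k ↔ ∀ i, v i = 0 ∨ v i = 1 := by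
  simp [cubeVertices]

lemma card_cubeVertices (k : ℕ) : (cubeVertices k).card = 2 ^ k := by
  simp [cubeVertices]

/-- Coordinatewise rounding to the nearest hypercube vertex. -/
noncomputable def roundToCube {k : ℕ} (P : Fin k → ℝ) : Fin k → ℝ :=
  fun i => if 1 / 2 < P i then 1 else 0

lemma roundToCube_of_mem {k : ℕ} {v : Fin k → ℝ} (hv : v ∈ cubeVertices k) :
    roundToCube v = v := by
  funext i
  rcases mem_cubeVertices.1 hv i with h | h <;> norm_num [roundToCube, h]

lemma roundToCube_extension {k : ℕ} {a b : Fin k → ℝ} (ha : a ∈ cubeVertices k)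
    (hb : b ∈ cubeVertices k) {s : ℝ} (hs : 1 ≤ s) :
    roundToCube (fun i => a i + s * (b i - a i)) = b := by
  funext i
  unfold roundToCube
  rcases mem_cubeVertices.1 ha i with h | h <;> rcases mem_cubeVertices.1 hb i with h' | h' <;>
    simp only [h, h'] <;> split_ifs <;> linarith

/-- If two distinct points lie on a segment, its right endpoint is reached by prolonging the
segment between them beyond one of the two. -/
lemma exists_extension_of_mem_segment {k : ℕ} {X P a b : Fin k → ℝ} (hab : a ≠ b)
    (ha : a ∈ segment ℝ X P) (hb : b ∈ segment ℝ X P) :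
    ∃ s : ℝ, 1 ≤ s ∧ (P = (fun i => a i + s * (b i - a i)) ∨
      P = fun i => b i + s * (a i - b i)) := by
  rw [segment_eq_image'] at ha hb
  obtain ⟨α, hα, rfl⟩ := ha
  obtain ⟨β, hβ, rfl⟩ := hb
  rcases lt_trichotomy α β with h | h | h
  · have h0 : 0 < β - α := by linarith
    refine ⟨(1 - α) / (β - α), by rw [le_div_iff₀ h0]; linarith [hβ.2], Or.inl ?_⟩
    funext i
    simp only [Pi.add_apply, Pi.smul_apply, Pi.sub_apply, smul_eq_mul]
    field_simp
    ring
  · exact absurd (by rw [h]) hab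
  · have h0 : 0 < α - β := by linarith
    refine ⟨(1 - β) / (α - β), by rw [le_div_iff₀ h0]; linarith [hα.2], Or.inr ?_⟩
    funext i
    simp only [Pi.add_apply, Pi.smul_apply, Pi.sub_apply, smul_eq_mul]
    field_simp
    ring

lemma eq_roundToCube_or_of_mem_segment {k : ℕ} {X P a b : Fin k → ℝ}
    (ha : a ∈ cubeVertices k) (hb : b ∈ cubeVertices k) (hab : a ≠ b)
    (ha' : a ∈ segment ℝ X P) (hb' : b ∈ segment ℝ X P) :
    a = roundToCube P ∨ b = roundToCube P := by
  obtain ⟨s, hs, h | h⟩ := exists_extension_of_mem_segment hab ha' hb'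
  · exact Or.inr (by rw [h, roundToCube_extension ha hb hs])
  · exact Or.inl (by rw [h, roundToCube_extension hb ha hs])

/-- The hypercube vertices lying on the segment `[X, P]`. -/
noncomputable def segmentVertices {k : ℕ} (X P : Fin k → ℝ) : Finset (Fin k → ℝ) :=
  open Classical in (cubeVertices k).filter (· ∈ segment ℝ X P)

lemma mem_segmentVertices {k : ℕ} {X P v : Fin k → ℝ} :
    v ∈ segmentVertices X P ↔ v ∈ cubeVertices k ∧ v ∈ segment ℝ X P := by
  simp [segmentVertices]

lemma segmentVertices_comm {k : ℕ} (X P : Fin k → ℝ) :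
    segmentVertices X P = segmentVertices P X := by
  ext v
  rw [mem_segmentVertices, mem_segmentVertices, segment_symm]

lemma card_segmentVertices_le {k : ℕ} (X P : Fin k → ℝ) :
    (segmentVertices X P).card ≤ 2 := by
  by_contra! h
  obtain ⟨a, ha, b, hb, c, hc, hab, hac, hbc⟩ := Finset.two_lt_card.1 h
  rw [mem_segmentVertices] at ha hb hc
  have h1 := eq_roundToCube_or_of_mem_segment ha.1 hb.1 hab ha.2 hb.2
  have h2 := eq_roundToCube_or_of_mem_segment ha.1 hc.1 hac ha.2 hc.2
  have h3 := eq_roundToCube_or_of_mem_segment hb.1 hc.1 hbc hb.2 hc.2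
  grind

lemma exists_pair_of_one_lt_card_segmentVertices {k : ℕ} {X P : Fin k → ℝ}
    (h : 1 < (segmentVertices X P).card) :
    ∃ a ∈ segmentVertices X P, ∃ b ∈ segmentVertices X P, ∃ s : ℝ, a ≠ b ∧ 1 ≤ s ∧
      P = fun i => a i + s * (b i - a i) := by
  obtain ⟨a, ha, b, hb, hab⟩ := Finset.one_lt_card.1 h
  obtain ⟨s, hs, h | h⟩ := exists_extension_of_mem_segment hab
    (mem_segmentVertices.1 ha).2 (mem_segmentVertices.1 hb).2
  · exact ⟨a, ha, b, hb, s, hab, hs, h⟩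
  · exact ⟨b, hb, a, ha, s, hab.symm, hs, h⟩

lemma roundToCube_mem_segmentVertices {k : ℕ} {X P : Fin k → ℝ}
    (h : 1 < (segmentVertices X P).card) : roundToCube P ∈ segmentVertices X P := by
  obtain ⟨a, ha, b, hb, s, -, hs, rfl⟩ := exists_pair_of_one_lt_card_segmentVertices h
  rwa [roundToCube_extension (mem_segmentVertices.1 ha).1 (mem_segmentVertices.1 hb).1 hs]

/-- Two consecutive links containing two hypercube vertices each share one of them. -/
lemma card_le_one_of_disjoint {k : ℕ} {X P Y : Fin k → ℝ}
    (hd : Disjoint (segmentVertices X P) (segmentVertices P Y)) :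
    (segmentVertices X P).card ≤ 1 ∨ (segmentVertices P Y).card ≤ 1 := by
  by_contra! h
  refine Finset.disjoint_left.1 hd (roundToCube_mem_segmentVertices h.1) ?_
  rw [segmentVertices_comm]
  exact roundToCube_mem_segmentVertices (by rw [segmentVertices_comm]; exact h.2)

/-- Coordinatewise consequences of the collinearity of a vertex `e` with prolongations of `[a, b]`
beyond `b` and of `[d, c]` beyond `c`. -/
lemma bit_collinear {a b c d e u p q : ℝ} (ha : a = 0 ∨ a = 1) (hb : b = 0 ∨ b = 1)
    (hc : c = 0 ∨ c = 1) (hd : d = 0 ∨ d = 1) (he : e = 0 ∨ e = 1) (hu0 : 0 < u) (hu1 : u < 1)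
    (hp : 1 - u < p) (hq : u < q) (h : e = (1 - u) * a + p * (b - a) + u * d + q * (c - d)) :
    (a ≠ d → p + u - q = 0 ∨ p + u - q = 1) ∧ (b ≠ d → p = 1) ∧ (a ≠ c → q = 1) := by
  rcases ha with rfl | rfl <;> rcases hb with rfl | rfl <;> rcases hc with rfl | rfl <;>
    rcases hd with rfl | rfl <;> rcases he with rfl | rfl <;>
    first
    | (exfalso; linarith)
    | (refine ⟨fun hh => ?_, fun hh => ?_, fun hh => ?_⟩ <;>
        first
        | exact absurd rfl hh
        | linarith
        | exact Or.inl (by linarith)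
        | exact Or.inr (by linarith))

/-- If the outer two of three consecutive links contain two hypercube vertices each, and those
four are distinct, then the middle link contains no further vertex. -/
lemma segmentVertices_middle_subset {k : ℕ} {X P Q Y : Fin k → ℝ}
    (hA : 1 < (segmentVertices X P).card) (hC : 1 < (segmentVertices Q Y).card)
    (hd : Disjoint (segmentVertices X P) (segmentVertices Q Y)) :
    segmentVertices P Q ⊆ segmentVertices X P ∪ segmentVertices Q Y := by
  intro e he
  by_contra hne
  rw [Finset.mem_union, not_or] at hne
  rw [segmentVertices_comm Q Y] at hC hd hne
  have hPmem := roundToCube_mem_segmentVertices hA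
  have hQmem := roundToCube_mem_segmentVertices hC
  have heP : e ≠ roundToCube P := fun h => hne.1 (h ▸ hPmem)
  have heQ : e ≠ roundToCube Q := fun h => hne.2 (h ▸ hQmem)
  have hPQ : roundToCube P ≠ roundToCube Q :=
    fun h => Finset.disjoint_left.1 hd hPmem (h ▸ hQmem)
  obtain ⟨a, ha, b, hb, s, hab, hs, hP⟩ := exists_pair_of_one_lt_card_segmentVertices hA
  obtain ⟨d, hdm, c, hc, t, hcd, ht, hQ⟩ := exists_pair_of_one_lt_card_segmentVertices hC
  have hac : a ≠ c := fun h => Finset.disjoint_left.1 hd ha (h ▸ hc)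
  have had : a ≠ d := fun h => Finset.disjoint_left.1 hd ha (h ▸ hdm)
  have hbd : b ≠ d := fun h => Finset.disjoint_left.1 hd hb (h ▸ hdm)
  rw [mem_segmentVertices] at ha hb hc hdm he
  have hPne : P ∉ cubeVertices k := by
    intro h
    have hr := roundToCube_of_mem h
    rcases eq_roundToCube_or_of_mem_segment h he.1 (fun h' => heP (by rw [hr, h']))
      (left_mem_segment ℝ P Q) he.2 with h' | h'
    · exact hPQ (by rw [hr, ← h'])
    · exact heQ h'
  have hQne : Q ∉ cubeVertices k := by
    intro h
    have hr := roundToCube_of_mem h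
    rcases eq_roundToCube_or_of_mem_segment h he.1 (fun h' => heQ (by rw [hr, h']))
      (left_mem_segment ℝ Q P) (segment_symm ℝ P Q ▸ he.2) with h' | h'
    · exact hPQ (by rw [hr, ← h'])
    · exact heP h'
  have hs1 : 1 < s := by
    refine lt_of_le_of_ne hs fun h => hPne ?_
    rw [hP, ← h]
    simpa using hb.1
  have ht1 : 1 < t := by
    refine lt_of_le_of_ne ht fun h => hQne ?_
    rw [hQ, ← h]
    simpa using hc.1
  have he2 := he.2
  rw [segment_eq_image] at he2
  obtain ⟨u, hu, hue⟩ := he2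
  have hu0 : 0 < u := by
    refine lt_of_le_of_ne hu.1 fun h => hPne ?_
    have : P = e := by simpa [← h] using hue
    exact this ▸ he.1
  have hu1 : u < 1 := by
    refine lt_of_le_of_ne hu.2 fun h => hQne ?_
    have : Q = e := by simpa [h] using hue
    exact this ▸ he.1
  have key := fun i => bit_collinear (p := (1 - u) * s) (q := u * t)
    (mem_cubeVertices.1 ha.1 i) (mem_cubeVertices.1 hb.1 i) (mem_cubeVertices.1 hc.1 i)
    (mem_cubeVertices.1 hdm.1 i) (mem_cubeVertices.1 he.1 i) hu0 hu1
    (by nlinarith) (by nlinarith)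
    (by
      rw [← hue, hP, hQ]
      simp only [Pi.add_apply, Pi.smul_apply, smul_eq_mul]
      ring)
  obtain ⟨i, hi⟩ := Function.ne_iff.1 had
  obtain ⟨j, hj⟩ := Function.ne_iff.1 hbd
  obtain ⟨l, hl⟩ := Function.ne_iff.1 hac
  have h2 := (key j).2.1 hj
  have h3 := (key l).2.2 hl
  rcases (key i).1 hi with h1 | h1 <;> linarith

open Classical in
lemma card_two_links_le {k : ℕ} (X P Y : Fin k → ℝ) :
    (segmentVertices X P ∪ segmentVertices P Y).card ≤ 3 := by
  have h1 := card_segmentVertices_le X P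
  have h2 := card_segmentVertices_le P Y
  have h3 := Finset.card_union_add_card_inter (segmentVertices X P) (segmentVertices P Y)
  by_cases hd : Disjoint (segmentVertices X P) (segmentVertices P Y)
  · have := card_le_one_of_disjoint hd
    omega
  · rw [Finset.disjoint_iff_inter_eq_empty, ← Finset.card_eq_zero] at hd
    omega

open Classical in
lemma card_three_links_le {k : ℕ} (X P Q Y : Fin k → ℝ) :
    (segmentVertices X P ∪ segmentVertices P Q ∪ segmentVertices Q Y).card ≤ 4 := by
  by_contra! h
  have hA := card_segmentVertices_le X P
  have hC := card_segmentVertices_le Q Y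
  have hAB := card_two_links_le X P Q
  have hBC := card_two_links_le P Q Y
  have hABC := Finset.card_union_le (segmentVertices X P ∪ segmentVertices P Q)
    (segmentVertices Q Y)
  have hBCA := Finset.card_union_le (segmentVertices X P)
    (segmentVertices P Q ∪ segmentVertices Q Y)
  rw [← Finset.union_assoc] at hBCA
  have hAC := Finset.card_union_add_card_inter (segmentVertices X P) (segmentVertices Q Y)
  by_cases hsub : segmentVertices P Q ⊆ segmentVertices X P ∪ segmentVertices Q Y
  · have := Finset.card_le_card (show segmentVertices X P ∪ segmentVertices P Q ∪
        segmentVertices Q Y ⊆ segmentVertices X P ∪ segmentVertices Q Y by grind)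
    omega
  · by_cases hd : Disjoint (segmentVertices X P) (segmentVertices Q Y)
    · exact hsub (segmentVertices_middle_subset (by omega) (by omega) hd)
    · rw [Finset.disjoint_iff_inter_eq_empty, ← Finset.card_eq_zero] at hd
      have hle : (segmentVertices X P ∪ segmentVertices P Q ∪ segmentVertices Q Y).card ≤
          (segmentVertices X P ∪ segmentVertices P Q).card +
            (segmentVertices Q Y \ (segmentVertices X P)).card := by
        refine (Finset.card_le_card ?_).trans (Finset.card_union_le _ _)
        grind
      have hsplit := Finset.card_sdiff_add_card_inter (segmentVertices Q Y) (segmentVertices X P)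
      rw [Finset.inter_comm] at hsplit
      omega

open Classical in
lemma card_links_le {k : ℕ} (T : ℕ → Fin k → ℝ) (q : ℕ) :
    ((Finset.range (3 * q + 2)).biUnion fun i => segmentVertices (T i) (T (i + 1))).card ≤
      4 * q + 3 := by
  induction q with
  | zero =>
    simpa [Finset.range_add_one, Finset.union_comm] using card_two_links_le (T 0) (T 1) (T 2)
  | succ q ih =>
    have h3 := card_three_links_le (T (3 * q + 2)) (T (3 * q + 3)) (T (3 * q + 4)) (T (3 * q + 5))
    have hsub : ((Finset.range (3 * (q + 1) + 2)).biUnion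
        fun i => segmentVertices (T i) (T (i + 1))) ⊆
        ((Finset.range (3 * q + 2)).biUnion fun i => segmentVertices (T i) (T (i + 1))) ∪
        (segmentVertices (T (3 * q + 2)) (T (3 * q + 3)) ∪
          segmentVertices (T (3 * q + 3)) (T (3 * q + 4)) ∪
          segmentVertices (T (3 * q + 4)) (T (3 * q + 5))) := by
      intro v hv
      obtain ⟨i, hi, hv⟩ := Finset.mem_biUnion.1 hv
      rw [Finset.mem_range] at hi
      simp only [Finset.mem_union, Finset.mem_biUnion, Finset.mem_range]
      by_cases h : i < 3 * q + 2
      · exact Or.inl ⟨i, h, hv⟩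
      · have : i = 3 * q + 2 ∨ i = 3 * q + 3 ∨ i = 3 * q + 4 := by omega
        rcases this with rfl | rfl | rfl <;> tauto
    have := (Finset.card_le_card hsub).trans (Finset.card_union_le _ _)
    omega

lemma le_length_of_covering {n m : ℕ} (S : Fin (m + 1) → (Fin (n + 2) → ℝ))
    (hS : ∀ v : Fin (n + 2) → ℝ, (∀ i, v i = 0 ∨ v i = 1) →
      ∃ j : Fin m, v ∈ segment ℝ (S j.castSucc) (S j.succ)) :
    3 * 2 ^ n ≤ m := by
  classical
  by_contra! h
  obtain ⟨q, hq⟩ : ∃ q, 2 ^ n = q + 1 := ⟨2 ^ n - 1, by have := Nat.two_pow_pos n; omega⟩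
  let T : ℕ → Fin (n + 2) → ℝ := fun i => S ⟨min i m, by omega⟩
  have hsub : cubeVertices (n + 2) ⊆
      (Finset.range (3 * q + 2)).biUnion fun i => segmentVertices (T i) (T (i + 1)) := by
    intro v hv
    obtain ⟨j, hj⟩ := hS v (mem_cubeVertices.1 hv)
    refine Finset.mem_biUnion.2 ⟨j, Finset.mem_range.2 (by omega),
      mem_segmentVertices.2 ⟨hv, ?_⟩⟩
    have h1 : T j = S j.castSucc := congrArg S (Fin.ext (by simp [j.2.le]))
    have h2 : T (j + 1) = S j.succ := congrArg S (Fin.ext (by simp [Nat.succ_le_of_lt j.2]))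
    rwa [h1, h2]
  have := (Finset.card_le_card hsub).trans (card_links_le T q)
  rw [card_cubeVertices, pow_add] at this
  omega

/-- The `j`-th triangle of the optimal closed chain has the apex `(1/2, …, 1/2, 2)` and a base on
the diagonal of the facet `x_{n+1} = 0` through the vertex given by the binary digits of `j`. The
`r`-th vertex of that triangle is listed here. -/
noncomputable def trianglePoint (n j r : ℕ) : Fin (n + 2) → ℝ := fun i =>
  if r = 0 then (if i.val = n + 1 then 2 else 1 / 2)
  else if i.val = n + 1 then 0
  else if r = 1 then (if j.testBit i then 3 / 2 else -1 / 2)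
  else (if j.testBit i then -1 / 2 else 3 / 2)

lemma trianglePoint_zero (n j j' : ℕ) : trianglePoint n j 0 = trianglePoint n j' 0 := rfl

lemma mem_triangle {n : ℕ} {v : Fin (n + 2) → ℝ} (hv : ∀ i, v i = 0 ∨ v i = 1) :
    ∃ j < 2 ^ n, v ∈ segment ℝ (trianglePoint n j 0) (trianglePoint n j 1) ∨
      v ∈ segment ℝ (trianglePoint n j 1) (trianglePoint n j 2) ∨
      v ∈ segment ℝ (trianglePoint n j 2) (trianglePoint n j 0) := by
  let x : ℝ := v ⟨n, by omega⟩
  let j : ℕ := Nat.ofBits fun i : Fin n => decide (v ⟨i, by omega⟩ ≠ x)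
  have hj : ∀ i : Fin (n + 2), i.val ≠ n + 1 → (j.testBit i = true ↔ v i ≠ x) := by
    intro i hi
    by_cases h : i.val < n
    · simp [j, Nat.testBit_ofBits_lt _ _ h]
    · have hin : i = ⟨n, by omega⟩ := Fin.ext (by simp; omega)
      simp [hin, j, x, Nat.testBit_ofBits_ge]
  have seg : ∀ (P Q : Fin (n + 2) → ℝ) (a b : ℝ), 0 ≤ a → 0 ≤ b → a + b = 1 →
      (∀ i, a * P i + b * Q i = v i) → v ∈ segment ℝ P Q :=
    fun P Q a b ha hb hab h => ⟨a, b, ha, hb, hab, funext h⟩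
  refine ⟨j, Nat.ofBits_lt_two_pow _, ?_⟩
  have hlast : ∀ i : Fin (n + 2), i.val = n + 1 → v i = v (Fin.last _) :=
    fun i hi => congrArg v (Fin.ext hi)
  rcases hv ⟨n, by omega⟩ with hx | hx <;> rcases hv (Fin.last _) with hy | hy
  · refine Or.inr (Or.inl (seg _ _ (3 / 4) (1 / 4) (by norm_num) (by norm_num) (by norm_num) ?_))
    intro i
    have := hj i
    have := hlast i
    rcases hv i with h | h <;> by_cases hi : i.val = n + 1 <;> by_cases hb : j.testBit i <;>
      simp_all [trianglePoint, x] <;> norm_num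
  · refine Or.inl (seg _ _ (1 / 2) (1 / 2) (by norm_num) (by norm_num) (by norm_num) ?_)
    intro i
    have := hj i
    have := hlast i
    rcases hv i with h | h <;> by_cases hi : i.val = n + 1 <;> by_cases hb : j.testBit i <;>
      simp_all [trianglePoint, x] <;> norm_num
  · refine Or.inr (Or.inl (seg _ _ (1 / 4) (3 / 4) (by norm_num) (by norm_num) (by norm_num) ?_))
    intro i
    have := hj i
    have := hlast i
    rcases hv i with h | h <;> by_cases hi : i.val = n + 1 <;> by_cases hb : j.testBit i <;>
      simp_all [trianglePoint, x] <;> norm_num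
  · refine Or.inr (Or.inr (seg _ _ (1 / 2) (1 / 2) (by norm_num) (by norm_num) (by norm_num) ?_))
    intro i
    have := hj i
    have := hlast i
    rcases hv i with h | h <;> by_cases hi : i.val = n + 1 <;> by_cases hb : j.testBit i <;>
      simp_all [trianglePoint, x] <;> norm_num

lemma exists_closed_covering (n : ℕ) :
    ∃ S : Fin (3 * 2 ^ n + 1) → (Fin (n + 2) → ℝ),
      S (Fin.last (3 * 2 ^ n)) = S 0 ∧
      ∀ v : Fin (n + 2) → ℝ, (∀ i, v i = 0 ∨ v i = 1) →
        ∃ j : Fin (3 * 2 ^ n), v ∈ segment ℝ (S j.castSucc) (S j.succ) := by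
  let T : ℕ → Fin (n + 2) → ℝ := fun i => trianglePoint n (i / 3) (i % 3)
  have hT0 : ∀ j, T (3 * j) = trianglePoint n j 0 := fun j => by simp [T]
  have hT1 : ∀ j, T (3 * j + 1) = trianglePoint n j 1 := fun j => by
    simp only [T]; congr 1 <;> omega
  have hT2 : ∀ j, T (3 * j + 2) = trianglePoint n j 2 := fun j => by
    simp only [T]; congr 1 <;> omega
  have hT3 : ∀ j, T (3 * j + 2 + 1) = trianglePoint n j 0 := fun j => by
    rw [show 3 * j + 2 + 1 = 3 * (j + 1) by ring, hT0, trianglePoint_zero]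
  refine ⟨fun i => T i, ?_, fun v hv => ?_⟩
  · simp only [Fin.val_last, Fin.val_zero]
    rw [hT0, trianglePoint_zero n (2 ^ n) 0, ← hT0, mul_zero]
  · obtain ⟨j, hj, h | h | h⟩ := mem_triangle hv
    · exact ⟨⟨3 * j, by omega⟩, by simpa [hT0, hT1] using h⟩
    · exact ⟨⟨3 * j + 1, by omega⟩, by simpa [hT1, hT2] using h⟩
    · refine ⟨⟨3 * j + 2, by omega⟩, ?_⟩
      simp only [Fin.val_castSucc, Fin.val_succ]
      rwa [hT2, hT3]

/-- (Main result) For `k ≥ 2`, the minimum number of links of a polygonal chain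
in `ℝ^k` covering the vertex set `{0,1}^k` equals `3 · 2^(k-2)`: there is a
covering chain (indeed a closed one) with `3 · 2^(k-2)` links, and every
covering chain has at least `3 · 2^(k-2)` links. -/
theorem min_links_covering_chain_eq (k : ℕ) (hk : 2 ≤ k) :
    (∃ S : Fin (3 * 2 ^ (k - 2) + 1) → (Fin k → ℝ),
      S (Fin.last (3 * 2 ^ (k - 2))) = S 0 ∧
      ∀ v : Fin k → ℝ, (∀ i, v i = 0 ∨ v i = 1) →
        ∃ j : Fin (3 * 2 ^ (k - 2)), v ∈ segment ℝ (S j.castSucc) (S j.succ)) ∧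
    (∀ (m : ℕ) (S : Fin (m + 1) → (Fin k → ℝ)),
      (∀ v : Fin k → ℝ, (∀ i, v i = 0 ∨ v i = 1) →
        ∃ j : Fin m, v ∈ segment ℝ (S j.castSucc) (S j.succ)) →
      3 * 2 ^ (k - 2) ≤ m) := by
  obtain ⟨n, rfl⟩ := Nat.exists_eq_add_of_le' hk
  exact ⟨exists_closed_covering n, fun m S hS => le_length_of_covering S hS⟩
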